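/- arXiv:0803.1825 — 5 statements merged into one kernel-verified Lean document; each statement's English description precedes it below -/
import Mathlib

section
/- Let f = (f_1, ..., f_n) : F_2^n → F_2^n be a monomial dynamical system over the field F_2 whose dependency graph is strongly connected with loop number t. Then the length of any limit cycle in the phase space of f divides t; that is, if x ∈ F_2^n is a periodic point of f of minimal period c, then c divides t. -/
/-- A directed walk of length `l` from `u` to `v` in the directed graph with
edge relation `G`. -/
def DWalk {V : Type*} (G : V → V → Prop) (l : ℕ) (u v : V) : Prop :=
  ∃ w : ℕ → V, w 0 = u ∧ w l = v ∧ ∀ i < l, G (w i) (w (i + 1))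

/-- `g` is the greatest common divisor of the set `A` of natural numbers. -/
def IsGcdOfSet (A : Set ℕ) (g : ℕ) : Prop :=
  (∀ a ∈ A, g ∣ a) ∧ ∀ d : ℕ, (∀ a ∈ A, d ∣ a) → d ∣ g

/-- For a monomial dynamical system `f = (f_1,…,f_n)` over `F_2` (each
coordinate `f_j = ∏ i, x_i ^ E j i` a nonconstant monomial) whose dependency graph
(edge `i → j` iff `x_i` appears in `f_j`) is strongly connected with loop number `t`,
the minimal period `c` of any periodic point divides `t`. -/
theorem stmt_3 (n : ℕ) (hn : 0 < n) (E : Fin n → Fin n → ℕ)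
    (hE : ∀ j : Fin n, ∃ i : Fin n, E j i ≠ 0)
    (f : (Fin n → ZMod 2) → Fin n → ZMod 2)
    (hf : ∀ (v : Fin n → ZMod 2) (j : Fin n), f v j = ∏ i : Fin n, v i ^ E j i)
    (hsc : ∀ u v : Fin n, ∃ l : ℕ, DWalk (fun i j => E j i ≠ 0) l u v)
    (v0 : Fin n) (t : ℕ)
    (ht : IsGcdOfSet {l : ℕ | 0 < l ∧ DWalk (fun i j => E j i ≠ 0) l v0 v0} t)
    (x : Fin n → ZMod 2) (c : ℕ) (hc : 0 < c) (hx : f^[c] x = x)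
    (hmin : ∀ m : ℕ, 0 < m → f^[m] x = x → c ≤ m) :
    c ∣ t := by
  have hstep : ∀ (y : Fin n → ZMod 2) (i j : Fin n), E j i ≠ 0 → y i = 0 → f y j = 0 := by
    intro y i j hij hy
    rw [hf]
    exact Finset.prod_eq_zero (Finset.mem_univ i) (by rw [hy, zero_pow hij])
  have hwalk : ∀ (l : ℕ) (u v : Fin n), DWalk (fun i j => E j i ≠ 0) l u v →
      ∀ k : ℕ, (f^[k] x) u = 0 → (f^[k + l] x) v = 0 := by
    rintro l u v ⟨w, h0, hl, hw⟩ k hk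
    have key : ∀ i ≤ l, (f^[k + i] x) (w i) = 0 := by
      intro i
      induction i with
      | zero => intro _; simpa [h0] using hk
      | succ i ih =>
        intro hi
        rw [← add_assoc, Function.iterate_succ_apply']
        exact hstep _ _ _ (hw i (by omega)) (ih (by omega))
    rw [← hl]
    exact key l le_rfl
  have hper : ∀ k m : ℕ, f^[k + c * m] x = f^[k] x := by
    intro k m
    rw [Function.iterate_add_apply]
    congr 1
    exact Function.IsPeriodicPt.mul_const (f := f) (m := c) hx m
  have hclosed : ∀ (L : ℕ) (u : Fin n),
      (∀ k : ℕ, (f^[k] x) u = 0 → (f^[k + L] x) u = 0) →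
      ∀ k : ℕ, (f^[k + L] x) u = (f^[k] x) u := by
    intro L u h k
    have hit : ∀ m k : ℕ, (f^[k] x) u = 0 → (f^[k + m * L] x) u = 0 := by
      intro m
      induction m with
      | zero => intro k hk; simpa using hk
      | succ m ih =>
        intro k hk
        have := h _ (ih k hk)
        rwa [add_assoc, ← Nat.succ_mul] at this
    have hback : (f^[k + L] x) u = 0 → (f^[k] x) u = 0 := by
      intro h1
      have h2 := hit (c - 1) _ h1
      have e : k + L + (c - 1) * L = k + c * L := by
        obtain ⟨d, rfl⟩ : ∃ d, c = d + 1 := ⟨c - 1, by omega⟩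
        simp only [Nat.add_sub_cancel]
        ring
      rwa [e, hper] at h2
    have hz : ∀ a b : ZMod 2, (a = 0 → b = 0) → (b = 0 → a = 0) → a = b := by decide
    exact hz _ _ hback (h k)
  refine ht.2 c ?_
  rintro l ⟨_, hl⟩
  have hxl : f^[l] x = x := by
    funext u
    obtain ⟨a, ha⟩ := hsc u v0
    obtain ⟨b, hb⟩ := hsc v0 u
    have h1 := hclosed (a + b) u (fun k hk => by
      rw [← add_assoc]
      exact hwalk _ _ _ hb _ (hwalk _ _ _ ha _ hk)) l
    have h2 := hclosed (a + l + b) u (fun k hk => by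
      rw [← add_assoc, ← add_assoc]
      exact hwalk _ _ _ hb _ (hwalk _ _ _ hl _ (hwalk _ _ _ ha _ hk))) 0
    rw [← h1, show l + (a + b) = 0 + (a + l + b) by ring, h2]
    rfl
  have hcp : Function.IsPeriodicPt f c x := hx
  have hmp : Function.minimalPeriod f x = c := by
    apply le_antisymm (hcp.minimalPeriod_le hc)
    exact hmin _ (hcp.minimalPeriod_pos hc) (Function.iterate_minimalPeriod)
  rw [← hmp]
  exact Function.IsPeriodicPt.minimalPeriod_dvd hxl
end

section
/- Let f = (f_1, ..., f_n) : F_2^n → F_2^n be a monomial dynamical system over the field F_2. Then all periodic points of f are fixed points if and only if every strongly connected component of the dependency graph of f has loop number 1. -/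
lemma dwalk_zero {V : Type*} (G : V → V → Prop) (u v : V) : DWalk G 0 u v ↔ u = v := by
  constructor
  · rintro ⟨w, h0, h1, -⟩
    exact h0.symm.trans h1
  · rintro rfl
    exact ⟨fun _ => u, rfl, rfl, fun i hi => absurd hi (Nat.not_lt_zero i)⟩

lemma dwalk_add {V : Type*} (G : V → V → Prop) (a b : ℕ) (u v : V) :
    DWalk G (a + b) u v ↔ ∃ m, DWalk G a u m ∧ DWalk G b m v := by
  constructor
  · rintro ⟨w, h0, h1, h⟩
    refine ⟨w a, ⟨w, h0, rfl, fun i hi => h i (by omega)⟩, ⟨fun i => w (a + i), rfl, h1, ?_⟩⟩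
    intro i hi
    exact h (a + i) (by omega)
  · rintro ⟨m, ⟨w, h0, h1, h⟩, ⟨w', h0', h1', h'⟩⟩
    refine ⟨fun i => if i ≤ a then w i else w' (i - a), by simp [h0], ?_, ?_⟩
    · by_cases hb : b = 0
      · subst hb
        simp [h1, ← h1', h0']
      · have : ¬ (a + b ≤ a) := by omega
        simp [hb, h1']
    · intro i hi
      rcases lt_trichotomy i a with hia | hia | hia
      · have h1 : i ≤ a := by omega
        have h2 : i + 1 ≤ a := by omega
        simp only [h1, h2, if_true]
        exact h i hia
      · subst hia
        have h2 : ¬ (i + 1 ≤ i) := by omega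
        have h3 := h' 0 (by omega)
        simp only [le_refl, if_true, h2, if_false, h1]
        rw [h0'] at h3
        simpa using h3
      · have h1 : ¬ i ≤ a := by omega
        have h2 : ¬ i + 1 ≤ a := by omega
        simp only [h1, h2, if_false]
        have h3 := h' (i - a) (by omega)
        rwa [show i - a + 1 = i + 1 - a by omega] at h3

lemma dwalk_one {V : Type*} (G : V → V → Prop) (u v : V) : DWalk G 1 u v ↔ G u v := by
  constructor
  · rintro ⟨w, h0, h1, h⟩
    have := h 0 (by omega)
    rwa [h0, show 0 + 1 = 1 from rfl, h1] at this
  · intro h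
    refine ⟨fun i => if i = 0 then u else v, by simp, by simp, ?_⟩
    intro i hi
    have : i = 0 := by omega
    subst this
    simpa using h

section
variable {n : ℕ} {E : Fin n → Fin n → ℕ} {f : (Fin n → ZMod 2) → Fin n → ZMod 2}

lemma iter_zero_iff
    (hf : ∀ (v : Fin n → ZMod 2) (j : Fin n), f v j = ∏ i : Fin n, v i ^ E j i)
    (m : ℕ) (x : Fin n → ZMod 2) (j : Fin n) :
    f^[m] x j = 0 ↔ ∃ i, x i = 0 ∧ DWalk (fun i j => E j i ≠ 0) m i j := by
  induction m generalizing j with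
  | zero => simp [dwalk_zero]
  | succ m ih =>
    rw [Function.iterate_succ_apply', hf, Finset.prod_eq_zero_iff]
    simp only [Finset.mem_univ, true_and, pow_eq_zero_iff', ih, dwalk_add, dwalk_one]
    constructor
    · rintro ⟨k, ⟨i, hi, hw⟩, hk⟩
      exact ⟨i, hi, k, hw, hk⟩
    · rintro ⟨i, hi, k, hw, hk⟩
      exact ⟨k, ⟨i, hi, hw⟩, hk⟩

lemma zmod2_ext {a b : ZMod 2} (h : a = 0 ↔ b = 0) : a = b := by
  revert a b; decide

/-- closed walks of all large lengths -/
lemma closed_large {V : Type*} (G : V → V → Prop) (v : V)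
    (hg : IsGcdOfSet {l : ℕ | 0 < l ∧ DWalk G l v v} 1) :
    ∃ N, ∀ l ≥ N, DWalk G l v v := by
  let S : AddSubmonoid ℕ :=
    { carrier := {l | DWalk G l v v}
      zero_mem' := (dwalk_zero G v v).2 rfl
      add_mem' := fun {a b} ha hb => (dwalk_add G a b v v).2 ⟨v, ha, hb⟩ }
  obtain ⟨N, hN⟩ := Nat.exists_mem_closure_of_ge {l : ℕ | 0 < l ∧ DWalk G l v v}
  have h1 : Nat.setGcd {l : ℕ | 0 < l ∧ DWalk G l v v} = 1 :=
    Nat.dvd_one.1 (hg.2 _ fun a ha => Nat.setGcd_dvd_of_mem ha)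
  refine ⟨N, fun l hl => ?_⟩
  have h2 := hN l hl (by rw [h1]; exact one_dvd _)
  have h3 : AddSubmonoid.closure {l : ℕ | 0 < l ∧ DWalk G l v v} ≤ S :=
    AddSubmonoid.closure_le.2 fun a ha => ha.2
  exact h3 h2

lemma zero_persist
    (hf : ∀ (v : Fin n → ZMod 2) (j : Fin n), f v j = ∏ i : Fin n, v i ^ E j i)
    (hg : ∀ v : Fin n,
      {l : ℕ | 0 < l ∧ DWalk (fun i j => E j i ≠ 0) l v v}.Nonempty →
      IsGcdOfSet {l : ℕ | 0 < l ∧ DWalk (fun i j => E j i ≠ 0) l v v} 1)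
    (x : Fin n → ZMod 2) (c : ℕ) (hc : 0 < c) (hx : f^[c] x = x) (j : Fin n) (hj : x j = 0)
    (m : ℕ) : f^[m] x j = 0 := by
  have hper : ∀ k, f^[k * c] x = x := by
    intro k
    have : Function.IsPeriodicPt f c x := hx
    exact this.const_mul k
  have step : ∀ u : {u // x u = 0}, ∃ u' : {u // x u = 0},
      DWalk (fun i j => E j i ≠ 0) c u'.1 u.1 := by
    rintro ⟨u, hu⟩
    have h := (iter_zero_iff hf c x u).1 (by rw [hx]; exact hu)
    obtain ⟨i, hi, hw⟩ := h
    exact ⟨⟨i, hi⟩, hw⟩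
  choose g hgw using step
  have walks : ∀ k (u : {u // x u = 0}),
      DWalk (fun i j => E j i ≠ 0) (k * c) (g^[k] u).1 u.1 := by
    intro k
    induction k with
    | zero => intro u; simp [dwalk_zero]
    | succ k ih =>
      intro u
      rw [Function.iterate_succ_apply', show (k + 1) * c = c + k * c by ring, dwalk_add]
      exact ⟨_, hgw _, ih u⟩
  obtain ⟨a, b, hab, heq⟩ : ∃ a b, a < b ∧ g^[a] ⟨j, hj⟩ = g^[b] ⟨j, hj⟩ := by
    obtain ⟨a, b, hab, heq⟩ :=
      Finite.exists_ne_map_eq_of_infinite (fun k : ℕ => g^[k] ⟨j, hj⟩)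
    rcases lt_or_gt_of_ne hab with h | h
    · exact ⟨a, b, h, heq⟩
    · exact ⟨b, a, h, heq.symm⟩
  obtain ⟨d, rfl⟩ := Nat.exists_eq_add_of_lt hab
  have hcl := walks (d + 1) (g^[a] ⟨j, hj⟩)
  rw [← Function.iterate_add_apply, show d + 1 + a = a + d + 1 by ring, ← heq] at hcl
  obtain ⟨N, hN⟩ := closed_large _ _ (hg _ ⟨_, Nat.mul_pos (Nat.succ_pos d) hc, hcl⟩)
  have hbig := hN (N * c + m) (by nlinarith)
  have h := (iter_zero_iff hf (N * c + m + a * c) x j).2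
    ⟨_, (g^[a] ⟨j, hj⟩).2, (dwalk_add _ _ _ _ _).2 ⟨_, hbig, walks a ⟨j, hj⟩⟩⟩
  rw [show N * c + m + a * c = m + (N + a) * c by ring, Function.iterate_add_apply, hper] at h
  exact h

end

/-- For a monomial dynamical system `f` over `F_2` (each coordinate
`f_j = ∏ i, x_i ^ E j i` a nonconstant monomial), all periodic points of `f` are fixed
points if and only if every strongly connected component of the dependency graph has loop
number 1, i.e. iff for every vertex `v` lying on some directed closed walk, the gcd of the
lengths of the closed walks based at `v` is `1`. -/
theorem stmt_4 (n : ℕ) (E : Fin n → Fin n → ℕ)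
    (hE : ∀ j : Fin n, ∃ i : Fin n, E j i ≠ 0)
    (f : (Fin n → ZMod 2) → Fin n → ZMod 2)
    (hf : ∀ (v : Fin n → ZMod 2) (j : Fin n), f v j = ∏ i : Fin n, v i ^ E j i) :
    (∀ x : Fin n → ZMod 2, (∃ c : ℕ, 0 < c ∧ f^[c] x = x) → f x = x) ↔
    (∀ v : Fin n,
      {l : ℕ | 0 < l ∧ DWalk (fun i j => E j i ≠ 0) l v v}.Nonempty →
      IsGcdOfSet {l : ℕ | 0 < l ∧ DWalk (fun i j => E j i ≠ 0) l v v} 1) := by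
  constructor
  · rintro H v ⟨L, hL, hLw⟩
    refine ⟨fun a _ => one_dvd a, fun d hd => ?_⟩
    classical
    let x : Fin n → ZMod 2 := fun j =>
      if ∃ l, d ∣ l ∧ DWalk (fun i j => E j i ≠ 0) l v j then 0 else 1
    have hx0 : ∀ j, x j = 0 ↔ ∃ l, d ∣ l ∧ DWalk (fun i j => E j i ≠ 0) l v j := by
      intro j
      simp only [x]
      split_ifs with h
      · simp [h]
      · simp [h]
    have hdL : d ∣ L := hd L ⟨hL, hLw⟩
    have hper : f^[L] x = x := by
      funext j
      apply zmod2_ext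
      rw [iter_zero_iff hf]
      constructor
      · rintro ⟨i, hi, hw⟩
        obtain ⟨l, hl, hwl⟩ := (hx0 i).1 hi
        exact (hx0 j).2 ⟨l + L, dvd_add hl hdL, (dwalk_add _ _ _ _ _).2 ⟨i, hwl, hw⟩⟩
      · intro hj
        obtain ⟨l, hl, hwl⟩ := (hx0 j).1 hj
        have h := (dwalk_add _ L l v j).2 ⟨v, hLw, hwl⟩
        rw [add_comm, dwalk_add] at h
        obtain ⟨i, h1, h2⟩ := h
        exact ⟨i, (hx0 i).2 ⟨l, hl, h1⟩, h2⟩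
    have hfix := H x ⟨L, hL, hper⟩
    have hv : x v = 0 := (hx0 v).2 ⟨0, dvd_zero d, (dwalk_zero _ _ _).2 rfl⟩
    obtain ⟨i, hi, hw⟩ := (iter_zero_iff hf 1 x v).1 (by
      rw [Function.iterate_one, hfix]; exact hv)
    obtain ⟨l, hl, hwl⟩ := (hx0 i).1 hi
    have h := hd (l + 1) ⟨Nat.succ_pos l, (dwalk_add _ _ _ _ _).2 ⟨i, hwl, hw⟩⟩
    exact (Nat.dvd_add_right hl).1 h
  · rintro H x ⟨c, hc, hx⟩
    funext j
    apply zmod2_ext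
    constructor
    · intro h
      have hy : f^[c] (f x) = f x := by
        rw [← Function.iterate_succ_apply, Function.iterate_succ_apply', hx]
      have h2 := zero_persist hf H (f x) c hc hy j h (c - 1)
      rw [← Function.iterate_succ_apply, show (c - 1).succ = c by omega, hx] at h2
      exact h2
    · intro h
      exact zero_persist hf H x c hc hx j h 1
end

section
/- Let f : F_2^n → F_2^n be a Boolean function in n variables depending on all n variables, written uniquely as f = Σ_{S ⊆ [n]} c_S Π_{i∈S} x_i with coefficients c_S ∈ F_2, and let σ be a permutation of [n] = {1,...,n}. Then f is a nested canalyzing function in the variable order x_{σ(1)}, x_{σ(2)}, ..., x_{σ(n)} (for some choice of canalyzing input values a_{σ(i)} and canalyzed output values b_{σ(i)}) if and only if c_{[n]} = 1 and, for every nonempty proper subset S ⊊ [n], c_S = c_{[r_S^σ]} · Π_{σ(i) ∈ [r_S^σ] \ S} c_{[n] \ {σ(i)}}, where [r_S^σ] denotes the completion of S with respect to σ. -/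
/-- `f` is a nested canalyzing function in the variable order
`x_{σ 0}, x_{σ 1}, …, x_{σ (n-1)}` with canalyzing input values `a` and canalyzed output
values `b`: if `x_{σ i} = a_{σ i}` and `x_{σ j} ≠ a_{σ j}` for all `j < i` then
`f x = b_{σ i}`, and if `x_{σ i} ≠ a_{σ i}` for all `i` then `f x = b_{σ (n-1)} + 1`. -/
def IsNCF {n : ℕ} (f : (Fin n → ZMod 2) → ZMod 2) (σ : Equiv.Perm (Fin n))
    (a b : Fin n → ZMod 2) : Prop :=
  ∀ x : Fin n → ZMod 2,
    (∀ i : Fin n, (∀ j : Fin n, j < i → x (σ j) ≠ a (σ j)) → x (σ i) = a (σ i) →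
      f x = b (σ i)) ∧
    ((∀ i : Fin n, x (σ i) ≠ a (σ i)) → ∀ h : n - 1 < n, f x = b (σ ⟨n - 1, h⟩) + 1)

/-- The completion `[r_S^σ]` of a (nonempty) subset `S ⊆ [n]` with respect to the
permutation `σ`: the set `{σ 0, σ 1, …, σ r}` where `r` is the largest element of
`σ⁻¹(S)`, i.e. the largest index `i` with `σ i ∈ S`. -/
def completion {n : ℕ} (σ : Equiv.Perm (Fin n)) (S : Finset (Fin n)) : Finset (Fin n) :=
  Finset.univ.filter fun j : Fin n =>
    ((σ.symm j : ℕ)) ≤ S.sup fun i : Fin n => ((σ.symm i : ℕ))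

namespace NCFProof

open Finset

/-- 0/1 indicator vector of a set. -/
def ind {n : ℕ} (T : Finset (Fin n)) : Fin n → ZMod 2 := fun i => if i ∈ T then 1 else 0

lemma z2 (u v : ZMod 2) (h : u ≠ v) : u = v + 1 := by
  revert u v; decide

lemma mobius {n : ℕ} (f : (Fin n → ZMod 2) → ZMod 2) (c : Finset (Fin n) → ZMod 2)
    (hc : ∀ x : Fin n → ZMod 2, f x = ∑ S : Finset (Fin n), c S * ∏ i ∈ S, x i)
    (S : Finset (Fin n)) : c S = ∑ T ∈ S.powerset, f (ind T) := by
  have h1 : ∀ T U : Finset (Fin n), ∏ i ∈ U, ind T i = if U ⊆ T then (1 : ZMod 2) else 0 := by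
    intro T U
    unfold ind
    split_ifs with h
    · exact Finset.prod_eq_one fun i hi => by simp [h hi]
    · obtain ⟨i, hi, hi'⟩ := Finset.not_subset.1 h
      exact Finset.prod_eq_zero hi (by simp [hi'])
  simp_rw [hc, h1]
  rw [Finset.sum_comm]
  rw [Finset.sum_eq_single S]
  · rw [Finset.sum_eq_single S]
    · simp
    · intro T hT hTS
      have : ¬ S ⊆ T := fun h => hTS (Finset.Subset.antisymm (Finset.mem_powerset.1 hT) h)
      simp [this]
    · simp
  · intro U _ hU
    rw [← Finset.mul_sum]
    have : ∑ T ∈ S.powerset, (if U ⊆ T then (1 : ZMod 2) else 0) = 0 := by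
      rw [← Finset.sum_filter, Finset.sum_const, nsmul_eq_mul, mul_one]
      by_cases hUS : U ⊆ S
      · have e : {T ∈ S.powerset | U ⊆ T} = Finset.Icc U S := by
          ext T; simp [and_comm]
        rw [e, Finset.card_Icc_finset hUS]
        have : U.card < S.card := Finset.card_lt_card (hUS.ssubset_of_ne hU)
        obtain ⟨k, hk⟩ := Nat.exists_eq_add_of_lt this
        rw [hk, show U.card + k + 1 - U.card = k + 1 by omega, pow_succ]
        push_cast
        rw [show (2 : ZMod 2) = 0 from rfl, mul_zero]
      · have e : {T ∈ S.powerset | U ⊆ T} = ∅ := by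
          apply Finset.filter_eq_empty_iff.2
          intro T hT h
          exact hUS (h.trans (Finset.mem_powerset.1 hT))
        simp [e]
    rw [this, mul_zero]
  · simp

/-- sums over subsets of a function insensitive to `m` vanish -/
lemma sum_toggle {n : ℕ} (S : Finset (Fin n)) (m : Fin n) (hm : m ∈ S)
    (g : Finset (Fin n) → ZMod 2) (hg : ∀ T, m ∉ T → g (insert m T) = g T) :
    ∑ T ∈ S.powerset, g T = 0 := by
  rw [← Finset.insert_erase hm, Finset.sum_powerset_insert (Finset.notMem_erase m S),
    ← Finset.sum_add_distrib]
  apply Finset.sum_eq_zero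
  intro T hT
  have : m ∉ T := fun h => Finset.notMem_erase m S (Finset.mem_powerset.1 hT h)
  rw [hg T this]
  exact CharTwo.add_self_eq_zero _

lemma insens {n : ℕ} (f : (Fin n → ZMod 2) → ZMod 2) (σ : Equiv.Perm (Fin n))
    (a b : Fin n → ZMod 2) (h : IsNCF f σ a b) (j m : Fin n) (hjm : σ.symm j < σ.symm m)
    (x y : Fin n → ZMod 2) (hxy : ∀ i, i ≠ m → x i = y i) (hx : x j = a j) : f x = f y := by
  classical
  have hex : ∃ i : Fin n, x (σ i) = a (σ i) ∧ ∀ k, k < i → x (σ k) ≠ a (σ k) := by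
    have hne : (Finset.univ.filter fun i : Fin n => x (σ i) = a (σ i)).Nonempty :=
      ⟨σ.symm j, by simp [hx]⟩
    refine ⟨Finset.min' _ hne, ?_, ?_⟩
    · exact (Finset.mem_filter.1 (Finset.min'_mem _ hne)).2
    · intro k hk hk'
      exact absurd (Finset.min'_le _ k (by simp [hk'])) (not_le.2 hk)
  obtain ⟨i, hi, hi'⟩ := hex
  have hij : i ≤ σ.symm j := by
    by_contra hlt
    exact hi' _ (not_le.1 hlt) (by simpa using hx)
  have hlt : ∀ k, k ≤ i → σ k ≠ m := by
    rintro k hk rfl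
    simp at hjm
    exact absurd (hk.trans hij) (not_le.2 hjm)
  rw [(h x).1 i hi' hi, (h y).1 i]
  · intro k hk
    rw [← hxy _ (hlt k hk.le)]
    exact hi' k hk
  · rw [← hxy _ (hlt i le_rfl)]
    exact hi

lemma step {n : ℕ} (f : (Fin n → ZMod 2) → ZMod 2) (c : Finset (Fin n) → ZMod 2)
    (hc : ∀ x : Fin n → ZMod 2, f x = ∑ S : Finset (Fin n), c S * ∏ i ∈ S, x i)
    (σ : Equiv.Perm (Fin n))
    (a b : Fin n → ZMod 2) (h : IsNCF f σ a b) (S : Finset (Fin n)) (j m : Fin n)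
    (hj : j ∉ S) (hm : m ∈ S) (hjm : σ.symm j < σ.symm m) :
    c S = c (insert j S) * a j := by
  have hne : j ≠ m := by rintro rfl; exact hj hm
  have key : ∀ a0, a0 = a j → c S + a0 * c (insert j S) = 0 := by
    intro a0 ha0
    rw [mobius f c hc S, mobius f c hc (insert j S), Finset.sum_powerset_insert hj]
    have h01 : a0 = 0 ∨ a0 = 1 := by
      clear ha0
      revert a0
      decide
    rcases h01 with h0 | h0
    · rw [h0, zero_mul, add_zero]
      have e : ∀ T ∈ S.powerset, f (ind T) = f (ind (T \ {j})) := by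
        intro T hT
        have : j ∉ T := fun h => hj (Finset.mem_powerset.1 hT h)
        rw [Finset.sdiff_singleton_eq_erase, Finset.erase_eq_of_notMem this]
      rw [Finset.sum_congr rfl e]
      apply sum_toggle S m hm
      intro T hT
      apply insens f σ a b h j m hjm
      · intro i hi; simp [ind, hi]
      · simp [ind, ← ha0, h0]
    · rw [h0, one_mul, ← add_assoc, CharTwo.add_self_eq_zero, zero_add]
      apply sum_toggle S m hm
      intro T hT
      apply insens f σ a b h j m hjm
      · intro i hi; simp [ind, hi]
      · simp [ind, ← ha0, h0]
  have := key _ rfl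
  rw [CharTwo.add_eq_zero] at this
  rw [this, mul_comm]

lemma top {n : ℕ} (hn : 0 < n) (f : (Fin n → ZMod 2) → ZMod 2) (c : Finset (Fin n) → ZMod 2)
    (hc : ∀ x : Fin n → ZMod 2, f x = ∑ S : Finset (Fin n), c S * ∏ i ∈ S, x i)
    (σ : Equiv.Perm (Fin n))
    (a b : Fin n → ZMod 2) (h : IsNCF f σ a b) : c Finset.univ = 1 := by
  have hl : n - 1 < n := by omega
  set l : Fin n := ⟨n - 1, hl⟩ with hldef
  have hle : ∀ i : Fin n, i ≠ l → i < l := by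
    intro i hi
    have : (i : ℕ) ≠ n - 1 := fun h => hi (Fin.ext h)
    exact Fin.lt_def.2 (by simp [l]; omega)
  set m := σ l with hmdef
  let z : Fin n → ZMod 2 := fun i => a i + 1
  let Z : Finset (Fin n) := Finset.univ.filter fun i => z i = 1
  have hZ : ind Z = z := by
    funext i
    simp only [ind, Z, Finset.mem_filter, Finset.mem_univ, true_and]
    generalize z i = w
    revert w; decide
  have hinj : ∀ T, ind T = z → T = Z := by
    intro T hT
    ext i
    simp only [Z, Finset.mem_filter, Finset.mem_univ, true_and, ← hT, ind]
    split_ifs with hi <;> simp [hi]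
  let δ : (Fin n → ZMod 2) → ZMod 2 := fun x => if x = z then 1 else 0
  have hins : ∀ x y : Fin n → ZMod 2, (∀ i, i ≠ m → x i = y i) → f x + δ x = f y + δ y := by
    intro x y hxy
    by_cases hx : ∃ j, j ≠ m ∧ x j = a j
    · obtain ⟨j, hj, hxj⟩ := hx
      have hjm : σ.symm j < σ.symm m := by
        rw [hmdef, Equiv.symm_apply_apply]
        apply hle
        intro h'
        exact hj (by rw [hmdef, ← h', Equiv.apply_symm_apply])
      have hd : ∀ w : Fin n → ZMod 2, w j = a j → δ w = 0 := by
        intro w hw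
        apply if_neg
        rintro rfl
        simp [z] at hw
      rw [insens f σ a b h j m hjm x y hxy hxj, hd x hxj, hd y (by rw [← hxy j hj, hxj])]
    · push Not at hx
      have hv : ∀ w : Fin n → ZMod 2, (∀ j, j ≠ m → w j ≠ a j) → f w + δ w = b m := by
        intro w hw
        have hw' : ∀ k, k < l → w (σ k) ≠ a (σ k) := by
          intro k hk
          apply hw
          intro h'
          exact hk.ne (σ.injective h')
        by_cases hwm : w m = a m
        · rw [(h w).1 l hw' hwm]
          have : δ w = 0 := by
            apply if_neg
            rintro rfl
            simp [z] at hwm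
          rw [this, add_zero]
        · have hall : ∀ i, w i ≠ a i := by
            intro i
            by_cases hi : i = m
            · rw [hi]; exact hwm
            · exact hw i hi
          rw [(h w).2 (fun i => hall _) hl]
          have : δ w = 1 := by
            apply if_pos
            funext i
            exact z2 _ _ (hall i)
          rw [this, add_assoc, CharTwo.add_self_eq_zero, add_zero]
      rw [hv x hx, hv y (fun j hj => by rw [← hxy j hj]; exact hx j hj)]
  have h0 : ∑ T ∈ (Finset.univ : Finset (Fin n)).powerset, (f (ind T) + δ (ind T)) = 0 := by
    apply sum_toggle _ m (Finset.mem_univ _)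
    intro T _
    apply hins
    intro i hi
    simp [ind, hi]
  rw [Finset.sum_add_distrib, ← mobius f c hc, CharTwo.add_eq_zero] at h0
  rw [h0, Finset.sum_eq_single Z]
  · simp [δ, hZ]
  · intro T _ hT
    exact if_neg fun h' => hT (hinj T h')
  · simp

lemma forward {n : ℕ} (hn : 0 < n) (f : (Fin n → ZMod 2) → ZMod 2)
    (c : Finset (Fin n) → ZMod 2)
    (hc : ∀ x : Fin n → ZMod 2, f x = ∑ S : Finset (Fin n), c S * ∏ i ∈ S, x i)
    (σ : Equiv.Perm (Fin n))
    (a b : Fin n → ZMod 2) (h : IsNCF f σ a b) (S : Finset (Fin n)) (hS : S.Nonempty) :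
    c S = c (completion σ S) * ∏ j ∈ completion σ S \ S, c (Finset.univ.erase j) := by
  obtain ⟨m, hm, hmax⟩ := Finset.exists_max_image S (fun i => (σ.symm i : ℕ)) hS
  have hsup : (S.sup fun i : Fin n => ((σ.symm i : ℕ))) = σ.symm m :=
    le_antisymm (Finset.sup_le hmax) (Finset.le_sup (f := fun i : Fin n => ((σ.symm i : ℕ))) hm)
  have hlt : ∀ j ∈ completion σ S \ S, σ.symm j < σ.symm m := by
    intro j hj
    simp only [completion, hsup, Finset.mem_sdiff, Finset.mem_filter, Finset.mem_univ,
      true_and] at hj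
    refine lt_of_le_of_ne (Fin.le_def.2 hj.1) ?_
    intro h'
    exact hj.2 (by rw [σ.symm.injective h']; exact hm)
  have hsub : S ⊆ completion σ S := by
    intro i hi
    simp only [completion, Finset.mem_filter, Finset.mem_univ, true_and]
    exact Finset.le_sup (f := fun i : Fin n => ((σ.symm i : ℕ))) hi
  have ha : ∀ j ∈ completion σ S \ S, c (Finset.univ.erase j) = a j := by
    intro j hj
    have hjS := (Finset.mem_sdiff.1 hj).2
    have hmj : m ≠ j := by rintro rfl; exact hjS hm
    rw [step f c hc σ a b h _ j m (Finset.notMem_erase _ _) (by simp [hmj]) (hlt j hj),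
      Finset.insert_erase (Finset.mem_univ _), top hn f c hc σ a b h, one_mul]
  have gen : ∀ D ⊆ completion σ S \ S, c S = c (D ∪ S) * ∏ j ∈ D, a j := by
    intro D
    induction D using Finset.induction_on with
    | empty => intro _; simp
    | insert j D hjD ih =>
      intro hD
      have hj := hD (Finset.mem_insert_self j D)
      rw [ih (fun i hi => hD (Finset.mem_insert_of_mem hi)), Finset.prod_insert hjD,
        step f c hc σ a b h (D ∪ S) j m _ (by simp [hm]) (hlt j hj), Finset.insert_union,
        mul_assoc]
      simp [hjD, (Finset.mem_sdiff.1 hj).2]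
  rw [gen _ (Finset.Subset.refl _), Finset.sdiff_union_of_subset hsub, Finset.prod_congr rfl ha]

/-- prefix sets -/
def pre {n : ℕ} (σ : Equiv.Perm (Fin n)) (k : ℕ) : Finset (Fin n) :=
  Finset.univ.filter fun j => (σ.symm j : ℕ) < k

lemma pre_succ {n : ℕ} (σ : Equiv.Perm (Fin n)) (k : Fin n) :
    pre σ (k + 1) = insert (σ k) (pre σ k) := by
  ext j
  have : j = σ k ↔ (σ.symm j : ℕ) = k := by
    rw [← Fin.ext_iff, Equiv.symm_apply_eq]
  simp only [pre, Finset.mem_filter, Finset.mem_univ, true_and, Finset.mem_insert, this]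
  omega

lemma pre_not {n : ℕ} (σ : Equiv.Perm (Fin n)) (k : Fin n) : σ k ∉ pre σ k := by
  simp [pre]

lemma pre_n {n : ℕ} (σ : Equiv.Perm (Fin n)) : pre σ n = Finset.univ := by
  simp [pre]

/-- partial sums -/
def part {n : ℕ} (c : Finset (Fin n) → ZMod 2) (σ : Equiv.Perm (Fin n)) (k : ℕ)
    (x : Fin n → ZMod 2) : ZMod 2 := ∑ S ∈ (pre σ k).powerset, c S * ∏ i ∈ S, x i

lemma part_congr {n : ℕ} (c : Finset (Fin n) → ZMod 2) (σ : Equiv.Perm (Fin n)) (k : ℕ)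
    (x y : Fin n → ZMod 2) (h : ∀ i ∈ pre σ k, x i = y i) : part c σ k x = part c σ k y := by
  apply Finset.sum_congr rfl
  intro S hS
  rw [Finset.prod_congr rfl fun i hi => h i (Finset.mem_powerset.1 hS hi)]

lemma part_succ {n : ℕ} (c : Finset (Fin n) → ZMod 2) (σ : Equiv.Perm (Fin n))
    (hS : ∀ S : Finset (Fin n), S.Nonempty → S ≠ Finset.univ →
          c S = c (completion σ S) *
            ∏ j ∈ completion σ S \ S, c (Finset.univ.erase j)) (k : Fin n)
    (x : Fin n → ZMod 2) :
    part c σ (k + 1) x = part c σ k x +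
      c (pre σ (k + 1)) * x (σ k) * ∏ j ∈ pre σ k, (x j + c (Finset.univ.erase j)) := by
  unfold part
  rw [pre_succ, Finset.sum_powerset_insert (pre_not σ k), Finset.prod_add, Finset.mul_sum]
  congr 1
  apply Finset.sum_congr rfl
  intro T hT
  rw [Finset.mem_powerset] at hT
  have hkT : σ k ∉ T := fun h => pre_not σ k (hT h)
  rw [Finset.prod_insert hkT]
  have hcoef : c (insert (σ k) T) = c (insert (σ k) (pre σ k)) *
      ∏ j ∈ pre σ k \ T, c (Finset.univ.erase j) := by
    by_cases hu : insert (σ k) T = Finset.univ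
    · have hTe : T = pre σ k := by
        apply Finset.Subset.antisymm hT
        intro i hi
        have : i ∈ insert (σ k) T := by rw [hu]; exact Finset.mem_univ _
        rcases Finset.mem_insert.1 this with h | h
        · exact absurd (h ▸ hi) (pre_not σ k)
        · exact h
      simp [hTe]
    · have hcomp : completion σ (insert (σ k) T) = insert (σ k) (pre σ k) := by
        have hsup : ((insert (σ k) T).sup fun i : Fin n => ((σ.symm i : ℕ))) = k := by
          rw [Finset.sup_insert, Equiv.symm_apply_apply]
          apply sup_eq_left.2
          apply Finset.sup_le
          intro i hi
          have := hT hi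
          simp only [pre, Finset.mem_filter, Finset.mem_univ, true_and] at this
          exact this.le
        rw [← pre_succ]
        ext j
        simp only [completion, hsup, pre, Finset.mem_filter, Finset.mem_univ, true_and]
        omega
      rw [hS _ (Finset.insert_nonempty _ _) hu, hcomp]
      congr 2
      ext j
      simp only [Finset.mem_sdiff, Finset.mem_insert]
      constructor
      · tauto
      · rintro ⟨h1, h2⟩
        refine ⟨Or.inr h1, ?_⟩
        rintro (h | h)
        · exact pre_not σ k (h ▸ h1)
        · exact h2 h
  rw [hcoef]
  ring

lemma backward {n : ℕ} (hn : 0 < n) (f : (Fin n → ZMod 2) → ZMod 2)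
    (c : Finset (Fin n) → ZMod 2)
    (hc : ∀ x : Fin n → ZMod 2, f x = ∑ S : Finset (Fin n), c S * ∏ i ∈ S, x i)
    (σ : Equiv.Perm (Fin n)) (h1 : c Finset.univ = 1)
    (hS : ∀ S : Finset (Fin n), S.Nonempty → S ≠ Finset.univ →
          c S = c (completion σ S) *
            ∏ j ∈ completion σ S \ S, c (Finset.univ.erase j)) :
    ∃ a b : Fin n → ZMod 2, IsNCF f σ a b := by
  let a : Fin n → ZMod 2 := fun j => c (Finset.univ.erase j)
  let y : Fin n → Fin n → ZMod 2 := fun m j => if j = m then a j else a j + 1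
  have hfn : ∀ x, f x = part c σ n x := by
    intro x
    rw [hc, part, pre_n, Finset.powerset_univ]
  have htail : ∀ (x : Fin n → ZMod 2) (i : Fin n), x (σ i) = a (σ i) →
      ∀ k : ℕ, (i : ℕ) + 1 ≤ k → k ≤ n → part c σ k x = part c σ (i + 1) x := by
    intro x i hi k hk
    induction k, hk using Nat.le_induction with
    | base => intro _; rfl
    | succ k hk ih =>
      intro hkn
      have := part_succ c σ hS ⟨k, by omega⟩ x
      simp only at this
      rw [this, ih (by omega)]
      have hz : ∏ j ∈ pre σ k, (x j + c (Finset.univ.erase j)) = 0 := by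
        apply Finset.prod_eq_zero (i := σ i)
        · simp [pre]; omega
        · rw [hi]; exact CharTwo.add_self_eq_zero _
      rw [hz, mul_zero, add_zero]
  refine ⟨a, fun m => f (y m), fun x => ⟨?_, ?_⟩⟩
  · intro i hlt hi
    show f x = f (y (σ i))
    rw [hfn, hfn, htail x i hi n i.2 le_rfl, htail (y (σ i)) i (by simp [y]) n i.2 le_rfl]
    apply part_congr
    intro j hj
    rw [pre_succ, Finset.mem_insert] at hj
    rcases hj with rfl | hj
    · simp [y, hi]
    · have hne : j ≠ σ i := by rintro rfl; exact pre_not σ i hj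
      simp only [y, hne, if_false]
      apply z2
      simp only [pre, Finset.mem_filter, Finset.mem_univ, true_and] at hj
      simpa using hlt (σ.symm j) (Fin.lt_def.2 hj)
  · intro hall hl
    show f x = f (y (σ ⟨n - 1, hl⟩)) + 1
    set l : Fin n := ⟨n - 1, hl⟩ with hldef
    have hx : ∀ j, x j = a j + 1 := fun j => z2 _ _ (by simpa using hall (σ.symm j))
    have hln : (l : ℕ) + 1 = n := by simp [l]; omega
    have hone : ∀ w : Fin n → ZMod 2, (∀ j ∈ pre σ l, w j = a j + 1) →
        f w = part c σ l w + w (σ l) := by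
      intro w hw
      have := part_succ c σ hS l w
      rw [hln, pre_n, h1, one_mul] at this
      rw [hfn, this, Finset.prod_eq_one, mul_one]
      intro j hj
      rw [hw j hj]
      show a j + 1 + a j = 1
      rw [add_right_comm, CharTwo.add_self_eq_zero, zero_add]
    have hyj : ∀ j ∈ pre σ l, y (σ l) j = a j + 1 := by
      intro j hj
      have hne : j ≠ σ l := by rintro rfl; exact pre_not σ l hj
      simp [y, hne]
    rw [hone x (fun j _ => hx j), hone _ hyj,
      part_congr c σ l x (y (σ l)) (fun j hj => by rw [hx, hyj j hj]), hx]
    simp [y, add_assoc]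

end NCFProof

/-- A Boolean function `f` in `n` variables, depending on all of them, with
square-free monomial expansion coefficients `c`, is a nested canalyzing function in the
variable order given by `σ` (for some inputs `a` and outputs `b`) iff `c [n] = 1` and for
every nonempty proper subset `S` of `[n]`,
`c S = c [r_S^σ] * ∏_{σ i ∈ [r_S^σ] \ S} c ([n] \ {σ i})`. -/
theorem stmt_7 (n : ℕ) (hn : 0 < n) (f : (Fin n → ZMod 2) → ZMod 2)
    (hdep : ∀ i : Fin n, ∃ x : Fin n → ZMod 2,
      f x ≠ f (Function.update x i (x i + 1)))
    (c : Finset (Fin n) → ZMod 2)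
    (hc : ∀ x : Fin n → ZMod 2, f x = ∑ S : Finset (Fin n), c S * ∏ i ∈ S, x i)
    (σ : Equiv.Perm (Fin n)) :
    (∃ a b : Fin n → ZMod 2, IsNCF f σ a b) ↔
      (c Finset.univ = 1 ∧
        ∀ S : Finset (Fin n), S.Nonempty → S ≠ Finset.univ →
          c S = c (completion σ S) *
            ∏ j ∈ completion σ S \ S, c (Finset.univ.erase j)) := by
  constructor
  · rintro ⟨a, b, h⟩
    exact ⟨NCFProof.top hn f c hc σ a b h,
      fun S hS _ => NCFProof.forward hn f c hc σ a b h S hS⟩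
  · rintro ⟨h1, h2⟩
    exact NCFProof.backward hn f c hc σ h1 h2
end

section
/- Identify each Boolean function in n variables with its coefficient vector (c_S)_{S ⊆ [n]} ∈ F_2^{2^n} via the square-free monomial expansion f = Σ_{S ⊆ [n]} c_S Π_{i∈S} x_i. Let V^{ncf} ⊆ F_2^{2^n} be the set of coefficient vectors of nested canalyzing functions in the variables x_1,...,x_n (in some variable order), and for a permutation σ of [n] let V_σ^{ncf} = {(c_S)_{S⊆[n]} ∈ F_2^{2^n} : c_{[n]} = 1 and c_S = c_{[r_S^σ]} Π_{σ(i) ∈ [r_S^σ]\S} c_{[n]\{σ(i)}} for all nonempty proper S ⊊ [n]}. Then V^{ncf} = ⋃_σ V_σ^{ncf}, the union taken over all permutations σ of [n]. -/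
/-- The Boolean function with square-free monomial expansion coefficients `c`. -/
def toFun {n : ℕ} (c : Finset (Fin n) → ZMod 2) : (Fin n → ZMod 2) → ZMod 2 :=
  fun x => ∑ S : Finset (Fin n), c S * ∏ i ∈ S, x i

/-- evaluation at the indicator of a set. -/
theorem toFun_indicator {n : ℕ} (c : Finset (Fin n) → ZMod 2) (T : Finset (Fin n)) :
    toFun c (fun i => if i ∈ T then 1 else 0) = ∑ S ∈ T.powerset, c S := by
  unfold toFun
  rw [← Finset.sum_subset (Finset.subset_univ T.powerset)]
  · refine Finset.sum_congr rfl fun S hS => ?_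
    rw [Finset.prod_eq_one, mul_one]
    intro i hi
    simp [Finset.mem_powerset.1 hS hi]
  · intro S _ hS
    rw [Finset.mem_powerset, Finset.not_subset] at hS
    obtain ⟨i, hi, hiT⟩ := hS
    rw [Finset.prod_eq_zero hi (by simp [hiT]), mul_zero]

theorem toFun_inj {n : ℕ} {c c' : Finset (Fin n) → ZMod 2} (h : toFun c = toFun c') : c = c' := by
  funext T
  induction T using Finset.strongInduction with
  | H T ih =>
    have h1 := congrFun h (fun i => if i ∈ T then 1 else 0)
    rw [toFun_indicator, toFun_indicator] at h1
    rw [← Finset.add_sum_erase _ _ (Finset.mem_powerset_self T),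
      ← Finset.add_sum_erase (a := T) _ c' (Finset.mem_powerset_self T)] at h1
    rw [Finset.sum_congr rfl (g := c')] at h1
    · exact add_right_cancel h1
    · intro S hS
      rw [Finset.mem_erase, Finset.mem_powerset] at hS
      exact ih S (Finset.ssubset_iff_subset_ne.2 ⟨hS.2, hS.1⟩)

/-- the first `k` elements in the order given by `σ`. -/
def initSeg {n : ℕ} (σ : Equiv.Perm (Fin n)) (k : ℕ) : Finset (Fin n) :=
  Finset.univ.filter fun j => (σ.symm j : ℕ) < k

theorem mem_initSeg {n : ℕ} (σ : Equiv.Perm (Fin n)) (k : ℕ) (j : Fin n) :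
    j ∈ initSeg σ k ↔ (σ.symm j : ℕ) < k := by simp [initSeg]

theorem initSeg_subset {n : ℕ} (σ : Equiv.Perm (Fin n)) {k m : ℕ} (hk : k ≤ n) :
    initSeg σ k ⊆ initSeg σ m ↔ k ≤ m := by
  constructor
  · intro h
    by_contra hlt
    push Not at hlt
    have := @h (σ ⟨m, by omega⟩) (by simp [mem_initSeg, hlt])
    simp [mem_initSeg] at this
  · intro h j hj
    rw [mem_initSeg] at *
    omega

theorem initSeg_n {n : ℕ} (σ : Equiv.Perm (Fin n)) : initSeg σ n = Finset.univ := by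
  ext j; simp [mem_initSeg]

/-- the normal form of a nested canalyzing function. -/
def nform {n : ℕ} (σ : Equiv.Perm (Fin n)) (d : ℕ → ZMod 2) (a : Fin n → ZMod 2) :
    (Fin n → ZMod 2) → ZMod 2 :=
  fun x => ∑ k ∈ Finset.range (n + 1), d k * ∏ j ∈ initSeg σ k, (x j + a j)

/-- the coefficients of the normal form. -/
def ncoef {n : ℕ} (σ : Equiv.Perm (Fin n)) (d : ℕ → ZMod 2) (a : Fin n → ZMod 2) :
    Finset (Fin n) → ZMod 2 :=
  fun S => ∑ k ∈ Finset.range (n + 1),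
    if S ⊆ initSeg σ k then d k * ∏ j ∈ initSeg σ k \ S, a j else 0

theorem toFun_ncoef {n : ℕ} (σ : Equiv.Perm (Fin n)) (d : ℕ → ZMod 2) (a : Fin n → ZMod 2) :
    toFun (ncoef σ d a) = nform σ d a := by
  funext x
  unfold toFun ncoef nform
  simp_rw [Finset.sum_mul]
  rw [Finset.sum_comm]
  refine Finset.sum_congr rfl fun k _ => ?_
  rw [Finset.prod_add, Finset.mul_sum, ← Finset.sum_subset (Finset.subset_univ _)]
  · refine Finset.sum_congr rfl fun S hS => ?_
    rw [if_pos (Finset.mem_powerset.1 hS)]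
    ring
  · intro S _ hS
    rw [if_neg (by simpa using hS), zero_mul]

theorem zmod2_add {x y : ZMod 2} (h : x ≠ y) : x + y = 1 := by
  revert x y; decide

theorem zmod2_self (x : ZMod 2) : x + x = 0 := by
  revert x; decide

theorem nform_first {n : ℕ} (σ : Equiv.Perm (Fin n)) (d : ℕ → ZMod 2) (a x : Fin n → ZMod 2)
    (i : Fin n) (h : ∀ j < i, x (σ j) ≠ a (σ j)) (hi : x (σ i) = a (σ i)) :
    nform σ d a x = ∑ k ∈ Finset.range (i + 1), d k := by
  unfold nform
  rw [← Finset.sum_subset (s₁ := Finset.range (i + 1))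
    (by intro k; simp only [Finset.mem_range]; omega)]
  · refine Finset.sum_congr rfl fun k hk => ?_
    rw [Finset.prod_eq_one, mul_one]
    intro j hj
    rw [mem_initSeg] at hj
    rw [Finset.mem_range] at hk
    have := h (σ.symm j) (by rw [Fin.lt_def]; omega)
    rw [Equiv.apply_symm_apply] at this
    exact zmod2_add this
  · intro k _ hk
    rw [Finset.mem_range] at hk
    rw [Finset.prod_eq_zero (i := σ i), mul_zero]
    · simp only [mem_initSeg, Equiv.symm_apply_apply]; omega
    · rw [hi, zmod2_self]

theorem nform_none {n : ℕ} (σ : Equiv.Perm (Fin n)) (d : ℕ → ZMod 2) (a x : Fin n → ZMod 2)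
    (h : ∀ j, x (σ j) ≠ a (σ j)) :
    nform σ d a x = ∑ k ∈ Finset.range (n + 1), d k := by
  unfold nform
  refine Finset.sum_congr rfl fun k hk => ?_
  rw [Finset.prod_eq_one, mul_one]
  intro j hj
  have := h (σ.symm j)
  rw [Equiv.apply_symm_apply] at this
  exact zmod2_add this

theorem isNCF_nform {n : ℕ} (hn : 0 < n) (σ : Equiv.Perm (Fin n)) (d : ℕ → ZMod 2)
    (a b : Fin n → ZMod 2) (hd : d n = 1)
    (hb : ∀ i : Fin n, b (σ i) = ∑ k ∈ Finset.range (i + 1), d k) :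
    IsNCF (nform σ d a) σ a b := by
  intro x
  constructor
  · intro i h hi
    rw [hb, nform_first σ d a x i h hi]
  · intro h hlt
    rw [hb, nform_none σ d a x h, Finset.sum_range_succ, hd]
    congr 3
    simp only
    omega

theorem isNCF_unique {n : ℕ} (hn : 0 < n) {f g : (Fin n → ZMod 2) → ZMod 2}
    {σ : Equiv.Perm (Fin n)} {a b : Fin n → ZMod 2} (hf : IsNCF f σ a b) (hg : IsNCF g σ a b) :
    f = g := by
  funext x
  by_cases h : ∃ i, x (σ i) = a (σ i)
  · have hex : ∃ i, x (σ i) = a (σ i) ∧ ∀ j, j < i → x (σ j) ≠ a (σ j) := by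
      obtain ⟨i, hi⟩ := h
      induction i using WellFoundedLT.induction with
      | ind i ih =>
        by_cases hj : ∃ j, j < i ∧ x (σ j) = a (σ j)
        · obtain ⟨j, hji, hj⟩ := hj
          exact ih j hji hj
        · push Not at hj
          exact ⟨i, hi, hj⟩
    obtain ⟨i, hi, hlt⟩ := hex
    rw [(hf x).1 i hlt hi, (hg x).1 i hlt hi]
  · push Not at h
    rw [(hf x).2 h (by omega), (hg x).2 h (by omega)]

theorem ncoef_univ_like {n : ℕ} (σ : Equiv.Perm (Fin n)) (d : ℕ → ZMod 2)
    (a : Fin n → ZMod 2) (hd : d n = 1) (S : Finset (Fin n))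
    (hS : ∀ k < n, ¬ S ⊆ initSeg σ k) :
    ncoef σ d a S = ∏ j ∈ Finset.univ \ S, a j := by
  unfold ncoef
  rw [Finset.sum_range_succ, Finset.sum_eq_zero, initSeg_n, hd]
  · simp
  · intro k hk
    rw [if_neg (hS k (Finset.mem_range.1 hk))]

theorem completion_spec {n : ℕ} (σ : Equiv.Perm (Fin n)) (S : Finset (Fin n))
    (hS : S.Nonempty) : ∃ r : Fin n, σ r ∈ S ∧ completion σ S = initSeg σ (r + 1) ∧
      ∀ k : ℕ, S ⊆ initSeg σ k ↔ (r : ℕ) < k := by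
  obtain ⟨i, hi, hsup⟩ := Finset.exists_mem_eq_sup S hS (fun i : Fin n => ((σ.symm i : ℕ)))
  refine ⟨σ.symm i, by simpa using hi, ?_, ?_⟩
  · ext j
    rw [mem_initSeg, completion, hsup]
    simp [Nat.lt_succ_iff]
  · intro k
    constructor
    · intro h
      have := h hi
      rwa [mem_initSeg] at this
    · intro h j hj
      rw [mem_initSeg]
      have : ((σ.symm j : ℕ)) ≤ S.sup (fun i : Fin n => ((σ.symm i : ℕ))) :=
        Finset.le_sup (f := fun i : Fin n => ((σ.symm i : ℕ))) hj
      rw [hsup] at this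
      omega

theorem ncoef_completion {n : ℕ} (σ : Equiv.Perm (Fin n)) (d : ℕ → ZMod 2)
    (a : Fin n → ZMod 2) (S : Finset (Fin n)) (hS : S.Nonempty) :
    ncoef σ d a S = ncoef σ d a (completion σ S) * ∏ j ∈ completion σ S \ S, a j := by
  obtain ⟨r, hr, hc, hk⟩ := completion_spec σ S hS
  rw [hc]
  unfold ncoef
  rw [Finset.sum_mul]
  refine Finset.sum_congr rfl fun k _ => ?_
  by_cases h : (r : ℕ) < k
  · have h1 : S ⊆ initSeg σ (r + 1) := (hk _).2 (by omega)
    have h2 : initSeg σ (r + 1) ⊆ initSeg σ k := (initSeg_subset σ (by omega)).2 (by omega)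
    rw [if_pos ((hk k).2 h), if_pos h2, mul_assoc, ← Finset.prod_union]
    · congr 2
      ext j
      simp only [Finset.mem_union, Finset.mem_sdiff]
      have h1 := @h1 j
      have h2 := @h2 j
      tauto
    · rw [Finset.disjoint_left]
      intro j
      simp only [Finset.mem_sdiff]
      tauto
  · rw [if_neg (by rw [hk]; exact h), if_neg, zero_mul]
    rw [initSeg_subset σ (by omega)]
    omega

theorem ncoef_erase {n : ℕ} (σ : Equiv.Perm (Fin n)) (d : ℕ → ZMod 2)
    (a : Fin n → ZMod 2) (hd : d n = 1) (j : Fin n) (hj : (σ.symm j : ℕ) + 1 < n) :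
    ncoef σ d a (Finset.univ.erase j) = a j := by
  rw [ncoef_univ_like σ d a hd]
  · rw [show Finset.univ \ Finset.univ.erase j = {j} by ext; simp]
    simp
  · intro k hk h
    have := @h (σ ⟨n - 1, by omega⟩) (by
      simp only [Finset.mem_erase, Finset.mem_univ, and_true]
      intro he
      rw [← he] at hj
      simp only [Equiv.symm_apply_apply] at hj
      omega)
    rw [mem_initSeg] at this
    simp at this
    omega

theorem ncoef_univ {n : ℕ} (σ : Equiv.Perm (Fin n)) (d : ℕ → ZMod 2)
    (a : Fin n → ZMod 2) (hd : d n = 1) : ncoef σ d a Finset.univ = 1 := by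
  rw [ncoef_univ_like σ d a hd]
  · simp
  · intro k hk
    rw [← initSeg_n σ, initSeg_subset σ le_rfl]
    omega

theorem ncoef_initSeg {n : ℕ} (σ : Equiv.Perm (Fin n)) (d : ℕ → ZMod 2)
    (a : Fin n → ZMod 2) (k : Fin n) :
    ncoef σ d a (initSeg σ k) = d k + a (σ k) * ncoef σ d a (initSeg σ (k + 1)) := by
  have key : d k = ∑ m ∈ Finset.range (n + 1), if m = (k : ℕ) then d k else 0 := by
    rw [Finset.sum_ite_eq', if_pos]
    rw [Finset.mem_range]; omega
  rw [key]
  unfold ncoef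
  rw [Finset.mul_sum, ← Finset.sum_add_distrib]
  refine Finset.sum_congr rfl fun m _ => ?_
  have e1 : initSeg σ k ⊆ initSeg σ m ↔ (k : ℕ) ≤ m := initSeg_subset σ (by omega)
  have e2 : initSeg σ (k + 1) ⊆ initSeg σ m ↔ (k : ℕ) + 1 ≤ m := initSeg_subset σ (by omega)
  simp only [e1, e2]
  rcases lt_trichotomy m (k : ℕ) with h | h | h
  · rw [if_neg (by omega), if_neg (by omega), if_neg (by omega)]; simp
  · subst h
    simp
  · rw [if_pos (by omega), if_neg (by omega), if_pos (by omega)]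
    have : initSeg σ m \ initSeg σ k = insert (σ k) (initSeg σ m \ initSeg σ (k + 1)) := by
      ext j
      simp only [Finset.mem_insert, Finset.mem_sdiff, mem_initSeg]
      rw [← Equiv.symm_apply_eq, Fin.ext_iff]
      omega
    rw [this, Finset.prod_insert (by simp [mem_initSeg])]
    ring

theorem toFun_depends {n : ℕ} (c : Finset (Fin n) → ZMod 2) (hc : c Finset.univ = 1)
    (i : Fin n) : ∃ x : Fin n → ZMod 2,
      toFun c x ≠ toFun c (Function.update x i (x i + 1)) := by
  by_contra h
  push Not at h
  have h0 : ∀ x, toFun c x = toFun c (Function.update x i 0) := by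
    intro x
    by_cases hx : x i = 0
    · rw [← hx, Function.update_eq_self]
    · rw [h x]
      have h3 : x i + 1 = 0 := by
        revert hx; generalize x i = y; revert y; decide
      rw [h3]
  have h1 : toFun c = toFun (fun S => if i ∈ S then 0 else c S) := by
    funext x
    rw [h0]
    unfold toFun
    refine Finset.sum_congr rfl fun S _ => ?_
    beta_reduce
    by_cases hS : i ∈ S
    · rw [if_pos hS, Finset.prod_eq_zero hS (by simp)]; simp
    · rw [if_neg hS]
      congr 1
      refine Finset.prod_congr rfl fun j hj => ?_
      rw [Function.update_of_ne]
      rintro rfl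
      exact hS hj
  have h2 := congrFun (toFun_inj h1) Finset.univ
  simp [hc] at h2

/-- Identifying Boolean functions with their coefficient vectors
`c : Finset (Fin n) → ZMod 2`, the set `V^{ncf}` of coefficient vectors of nested
canalyzing functions (in some variable order) equals the union over all permutations `σ`
of the sets `V_σ^{ncf}` cut out by the coefficient relations. -/
theorem stmt_8 (n : ℕ) (hn : 0 < n) :
    {c : Finset (Fin n) → ZMod 2 |
        (∀ i : Fin n, ∃ x : Fin n → ZMod 2,
          toFun c x ≠ toFun c (Function.update x i (x i + 1))) ∧
        ∃ (σ : Equiv.Perm (Fin n)) (a b : Fin n → ZMod 2), IsNCF (toFun c) σ a b} =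
      ⋃ σ : Equiv.Perm (Fin n),
        {c : Finset (Fin n) → ZMod 2 |
          c Finset.univ = 1 ∧
          ∀ S : Finset (Fin n), S.Nonempty → S ≠ Finset.univ →
            c S = c (completion σ S) *
              ∏ j ∈ completion σ S \ S, c (Finset.univ.erase j)} := by
  ext c
  simp only [Set.mem_ofPred_eq, Set.mem_iUnion]
  constructor
  · rintro ⟨-, σ, a, b, h⟩
    refine ⟨σ, ?_⟩
    -- partial sums of `d` are the outputs
    let B : ℕ → ZMod 2 := fun k => if h : k < n then b (σ ⟨k, h⟩) else b (σ ⟨n - 1, by omega⟩) + 1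
    let d : ℕ → ZMod 2 := fun k => match k with
      | 0 => B 0
      | k + 1 => B (k + 1) - B k
    have hsum : ∀ k, ∑ m ∈ Finset.range (k + 1), d m = B k := by
      intro k
      induction k with
      | zero => simp [d]
      | succ k ih => rw [Finset.sum_range_succ, ih]; simp [d]
    have hd : d n = 1 := by
      obtain ⟨m, rfl⟩ : ∃ m, n = m + 1 := ⟨n - 1, by omega⟩
      simp [d, B]
    have hN := isNCF_nform hn σ d a b hd (by
      intro i
      rw [hsum]
      simp [B])
    have hc : c = ncoef σ d a := by
      apply toFun_inj
      rw [toFun_ncoef]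
      exact isNCF_unique hn h hN
    subst hc
    refine ⟨ncoef_univ σ d a hd, fun S hS _ => ?_⟩
    rw [ncoef_completion σ d a S hS]
    congr 1
    refine Finset.prod_congr rfl fun j hj => ?_
    obtain ⟨r, hr, hcomp, -⟩ := completion_spec σ S hS
    rw [hcomp, Finset.mem_sdiff, mem_initSeg] at hj
    rw [ncoef_erase σ d a hd]
    have : σ.symm j ≠ r := by
      rintro rfl
      simp at hr
      exact hj.2 hr
    rw [Ne, Fin.ext_iff] at this
    omega
  · rintro ⟨σ, hc, hrel⟩
    refine ⟨toFun_depends c hc, σ, ?_⟩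
    let a : Fin n → ZMod 2 := fun j => c (Finset.univ.erase j)
    let d : ℕ → ZMod 2 := fun k => if h : k < n then
      c (initSeg σ k) - a (σ ⟨k, h⟩) * c (initSeg σ (k + 1)) else 1
    have hd : d n = 1 := by simp [d]
    have hseg : ∀ m k, k + m = n → ncoef σ d a (initSeg σ k) = c (initSeg σ k) := by
      intro m
      induction m with
      | zero =>
        intro k hk
        obtain rfl : k = n := by omega
        rw [initSeg_n, ncoef_univ σ d a hd, hc]
      | succ m ih =>
        intro k hk
        have h1 : k < n := by omega
        have := ncoef_initSeg σ d a ⟨k, h1⟩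
        simp only at this
        rw [this, ih (k + 1) (by omega)]
        simp [d, h1]
    have hceq : c = ncoef σ d a := by
      funext S
      rcases S.eq_empty_or_nonempty with rfl | hS
      · have := hseg n 0 (by omega)
        rw [show initSeg σ 0 = ∅ by ext; simp [mem_initSeg]] at this
        exact this.symm
      · by_cases hu : S = Finset.univ
        · rw [hu, ncoef_univ σ d a hd, hc]
        · rw [hrel S hS hu, ncoef_completion σ d a S hS]
          obtain ⟨r, hr, hcomp, -⟩ := completion_spec σ S hS
          rw [hcomp, hseg (n - (r + 1)) (r + 1) (by omega)]
    refine ⟨a, fun j => ∑ k ∈ Finset.range ((σ.symm j : ℕ) + 1), d k, ?_⟩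
    rw [hceq, toFun_ncoef]
    -- `a` and `d` mention `c`
    have := isNCF_nform hn σ d a (fun j => ∑ k ∈ Finset.range ((σ.symm j : ℕ) + 1), d k) hd
      (by intro i; simp)
    exact this
end

section
/- Let k be a finite field, let p_1, ..., p_r be distinct points in k^n and b_1, ..., b_r ∈ k, and let M ⊆ k[x_1,...,x_n] be the monomial ideal generated by the monomials Π_{i : (p_j)_i ≠ (p_l)_i} x_i over all pairs j ≠ l with b_j ≠ b_l (assume b_j ≠ b_l for at least one pair, so M is a proper nonzero monomial ideal). Then a prime ideal P = ⟨x_{j_1}, ..., x_{j_t}⟩ is a minimal prime of M if and only if the set S = {j_1,...,j_t} is minimal (with respect to inclusion) among subsets of [n] with the property that for every pair j, l with b_j ≠ b_l there exists i ∈ S with (p_j)_i ≠ (p_l)_i. -/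
open MvPolynomial in
theorem aux_ker (k : Type) [Field k] (n : ℕ) (T : Finset (Fin n)) :
    Ideal.span {q : MvPolynomial (Fin n) k | ∃ i ∈ T, q = MvPolynomial.X i} =
      RingHom.ker (aeval (R := k) (fun i : Fin n =>
        if i ∈ T then (0 : MvPolynomial (Fin n) k) else X i)) := by
  apply le_antisymm
  · rw [Ideal.span_le]
    rintro q ⟨i, hi, rfl⟩
    simp [RingHom.mem_ker, hi]
  · intro f hf
    rw [RingHom.mem_ker] at hf
    have key : ∀ f : MvPolynomial (Fin n) k, f - aeval (R := k) (fun i : Fin n =>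
        if i ∈ T then (0 : MvPolynomial (Fin n) k) else X i) f ∈
        Ideal.span {q : MvPolynomial (Fin n) k | ∃ i ∈ T, q = MvPolynomial.X i} := by
      intro f
      rw [← Ideal.Quotient.mk_eq_mk_iff_sub_mem]
      induction f using MvPolynomial.induction_on with
      | C a => simp [MvPolynomial.algebraMap_eq]
      | add f g hf hg => rw [map_add, map_add, map_add, hf, hg]
      | mul_X f i hf =>
        rw [map_mul, map_mul, map_mul, ← hf, aeval_X]
        congr 1
        split_ifs with hi
        · rw [Ideal.Quotient.mk_eq_mk_iff_sub_mem, sub_zero]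
          exact Ideal.subset_span ⟨i, hi, rfl⟩
        · rfl
    have := key f
    rwa [hf, sub_zero] at this

theorem aux_prime (k : Type) [Field k] (n : ℕ) (T : Finset (Fin n)) :
    (Ideal.span {q : MvPolynomial (Fin n) k | ∃ i ∈ T, q = MvPolynomial.X i}).IsPrime := by
  rw [aux_ker]
  exact RingHom.ker_isPrime _

theorem aux_mem (k : Type) [Field k] (n : ℕ) (T : Finset (Fin n)) (i : Fin n) :
    (MvPolynomial.X i : MvPolynomial (Fin n) k) ∈
      Ideal.span {q : MvPolynomial (Fin n) k | ∃ i ∈ T, q = MvPolynomial.X i} ↔ i ∈ T := by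
  rw [aux_ker, RingHom.mem_ker, MvPolynomial.aeval_X]
  split_ifs with h <;> simp [h]

/-- Let `M` be the monomial ideal generated by the monomials
`∏_{i : (p_j)_i ≠ (p_l)_i} x_i` over all pairs `j, l` with `b_j ≠ b_l` (with at least one
such pair). Then the prime ideal `P = ⟨x_i : i ∈ T⟩` is a minimal prime of `M` iff `T` is
minimal (w.r.t. inclusion) among the subsets of `[n]` separating the data, i.e. such that
any two points with different prescribed values differ in some coordinate in `T`. -/
theorem stmt_13 (k : Type) [Field k] [Fintype k] [DecidableEq k] (n r : ℕ)
    (p : Fin r → Fin n → k) (hp : Function.Injective p) (b : Fin r → k)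
    (hne : ∃ j l : Fin r, b j ≠ b l)
    (M : Ideal (MvPolynomial (Fin n) k))
    (hM : M = Ideal.span {m : MvPolynomial (Fin n) k | ∃ j l : Fin r, b j ≠ b l ∧
      m = ∏ i ∈ Finset.univ.filter (fun i : Fin n => p j i ≠ p l i), MvPolynomial.X i})
    (T : Finset (Fin n)) (P : Ideal (MvPolynomial (Fin n) k))
    (hP : P = Ideal.span {q : MvPolynomial (Fin n) k | ∃ i ∈ T, q = MvPolynomial.X i}) :
    P ∈ M.minimalPrimes ↔
      ((∀ j l : Fin r, b j ≠ b l → ∃ i ∈ T, p j i ≠ p l i) ∧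
        ∀ T' ⊆ T, (∀ j l : Fin r, b j ≠ b l → ∃ i ∈ T', p j i ≠ p l i) → T' = T) := by
  have hle : ∀ Q : Ideal (MvPolynomial (Fin n) k), Q.IsPrime → (M ≤ Q ↔
      ∀ j l : Fin r, b j ≠ b l →
        ∃ i, (MvPolynomial.X i : MvPolynomial (Fin n) k) ∈ Q ∧ p j i ≠ p l i) := by
    intro Q hQ
    rw [hM, Ideal.span_le]
    constructor
    · intro h j l hjl
      have h1 := h ⟨j, l, hjl, rfl⟩
      rw [SetLike.mem_coe, hQ.prod_mem_iff] at h1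
      obtain ⟨i, hi, hiQ⟩ := h1
      exact ⟨i, hiQ, (Finset.mem_filter.1 hi).2⟩
    · rintro h m ⟨j, l, hjl, rfl⟩
      obtain ⟨i, hiQ, hi⟩ := h j l hjl
      rw [SetLike.mem_coe, hQ.prod_mem_iff]
      exact ⟨i, Finset.mem_filter.2 ⟨Finset.mem_univ _, hi⟩, hiQ⟩
  have hspan : ∀ S : Finset (Fin n), (M ≤ Ideal.span
      {q : MvPolynomial (Fin n) k | ∃ i ∈ S, q = MvPolynomial.X i} ↔
      ∀ j l : Fin r, b j ≠ b l → ∃ i ∈ S, p j i ≠ p l i) := by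
    intro S
    rw [hle _ (aux_prime k n S)]
    simp only [aux_mem]
  subst hP
  constructor
  · rintro ⟨⟨_, hMP⟩, hmin⟩
    refine ⟨(hspan T).1 hMP, fun T' hT' hsep => ?_⟩
    have h2 := hmin ⟨aux_prime k n T', (hspan T').2 hsep⟩
      (Ideal.span_mono (by rintro q ⟨i, hi, rfl⟩; exact ⟨i, hT' hi, rfl⟩))
    refine Finset.Subset.antisymm hT' fun i hi => ?_
    exact (aux_mem k n T' i).1 (h2 ((aux_mem k n T i).2 hi))
  · rintro ⟨hsep, hmin⟩
    refine ⟨⟨aux_prime k n T, (hspan T).2 hsep⟩, ?_⟩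
    rintro Q ⟨hQ, hMQ⟩ hQP
    classical
    have h3 := hmin (Finset.univ.filter
      fun i => (MvPolynomial.X i : MvPolynomial (Fin n) k) ∈ Q)
      (fun i hi => (aux_mem k n T i).1 (hQP (Finset.mem_filter.1 hi).2))
      (by simpa using (hle Q hQ).1 hMQ)
    refine Ideal.span_le.2 ?_
    rintro q ⟨i, hi, rfl⟩
    rw [← h3] at hi
    exact (Finset.mem_filter.1 hi).2
end
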